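/- For l ∈ ℕ define φ_l : ℝ → ℂ by φ_l(ξ) = (1 − iξ)^l / (1 + iξ)^{l+1}. Then for every l ∈ ℕ, the function ξ ↦ (1/(1 − iξ)) · conj(φ_l(ξ)) is integrable on ℝ and ∫_ℝ (1/(1 − iξ)) · conj(φ_l(ξ)) dξ = 0; that is, the function ξ ↦ 1/(1 − iξ) = conj(φ_0(ξ)) is orthogonal in L²(ℝ) to every φ_l. (This expresses that the Wiener–Hopf operator with symbol (1 + iξ)/(1 − iξ) annihilates φ_0, since ((1 + iξ)/(1 − iξ))·φ_0(ξ) = 1/(1 − iξ).) -/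

import Mathlib

open MeasureTheory

open Filter Topology

/-- The Cayley transform of `ξ ∈ ℝ`. -/
noncomputable def cayley (ξ : ℝ) : ℂ := (1 + Complex.I * ξ) / (1 - Complex.I * ξ)

theorem one_sub_I_mul_ne_zero (ξ : ℝ) : 1 - Complex.I * (ξ : ℂ) ≠ 0 := fun h => by
  simpa using congrArg Complex.re h

theorem norm_one_sub_I_mul_sq (ξ : ℝ) : ‖1 - Complex.I * (ξ : ℂ)‖ ^ 2 = 1 + ξ ^ 2 := by
  rw [Complex.sq_norm, Complex.normSq_apply]
  simp
  ring

theorem norm_one_add_I_mul (ξ : ℝ) : ‖1 + Complex.I * (ξ : ℂ)‖ = ‖1 - Complex.I * (ξ : ℂ)‖ := by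
  rw [← Complex.norm_conj (1 + Complex.I * (ξ : ℂ))]
  simp [sub_eq_add_neg]

theorem norm_cayley (ξ : ℝ) : ‖cayley ξ‖ = 1 := by
  rw [cayley, norm_div, norm_one_add_I_mul,
    div_self (norm_ne_zero_iff.mpr (one_sub_I_mul_ne_zero ξ))]

theorem cayley_eq (ξ : ℝ) : cayley ξ = -1 + 2 * (1 - Complex.I * (ξ : ℂ))⁻¹ := by
  have := one_sub_I_mul_ne_zero ξ
  rw [cayley]
  field_simp
  ring

theorem continuous_cayley : Continuous cayley := by
  unfold cayley
  exact Continuous.div (by fun_prop) (by fun_prop) one_sub_I_mul_ne_zero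

theorem hasDerivAt_cayley (ξ : ℝ) :
    HasDerivAt cayley (2 * Complex.I / (1 - Complex.I * (ξ : ℂ)) ^ 2) ξ := by
  have h : HasDerivAt (fun x : ℝ => Complex.I * (x : ℂ)) Complex.I ξ := by
    simpa using (Complex.ofRealCLM.hasDerivAt (x := ξ)).const_mul Complex.I
  refine ((h.const_add 1).div (h.const_sub 1) (one_sub_I_mul_ne_zero ξ)).congr_deriv ?_
  ring

theorem tendsto_cayley_cocompact : Tendsto cayley (cocompact ℝ) (𝓝 (-1)) := by
  have h : Tendsto (fun ξ : ℝ => 1 - Complex.I * (ξ : ℂ)) (cocompact ℝ)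
      (Bornology.cobounded ℂ) := by
    rw [← tendsto_norm_atTop_iff_cobounded]
    refine tendsto_atTop_mono (fun ξ => ?_) tendsto_norm_cocompact_atTop
    rw [← sq_le_sq₀ (norm_nonneg _) (norm_nonneg _), norm_one_sub_I_mul_sq, Real.norm_eq_abs, sq_abs]
    exact le_add_of_nonneg_left zero_le_one
  rw [funext cayley_eq]
  simpa using ((tendsto_inv₀_cobounded.comp h).const_mul 2).const_add (-1)

theorem one_div_mul_conj_phi_eq (l : ℕ) (ξ : ℝ) :
    (1 / (1 - Complex.I * ξ)) *
        (starRingEnd ℂ) ((1 - Complex.I * ξ) ^ l / (1 + Complex.I * ξ) ^ (l + 1)) =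
      cayley ξ ^ l / (1 - Complex.I * (ξ : ℂ)) ^ 2 := by
  have := one_sub_I_mul_ne_zero ξ
  simp only [map_div₀, map_pow, map_sub, map_add, map_one, map_mul, Complex.conj_I,
    Complex.conj_ofReal, neg_mul, sub_neg_eq_add, ← sub_eq_add_neg, cayley, div_pow]
  field_simp
  ring

theorem integrable_cayley_pow_div (l : ℕ) :
    Integrable fun ξ : ℝ => cayley ξ ^ l / (1 - Complex.I * (ξ : ℂ)) ^ 2 := by
  refine integrable_inv_one_add_sq.mono' (Continuous.aestronglyMeasurable ?_) (.of_forall fun ξ => ?_)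
  · exact (continuous_cayley.pow l).div (by fun_prop)
      fun ξ => pow_ne_zero 2 (one_sub_I_mul_ne_zero ξ)
  · rw [norm_div, norm_pow, norm_pow, norm_cayley, norm_one_sub_I_mul_sq, one_pow, one_div]

theorem integral_cayley_pow_div (l : ℕ) :
    ∫ ξ : ℝ, cayley ξ ^ l / (1 - Complex.I * (ξ : ℂ)) ^ 2 = 0 := by
  have hderiv (ξ : ℝ) :
      HasDerivAt (fun x => cayley x ^ (l + 1) / (2 * Complex.I * (l + 1)))
        (cayley ξ ^ l / (1 - Complex.I * (ξ : ℂ)) ^ 2) ξ := by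
    have hl : (l : ℂ) + 1 ≠ 0 := Nat.cast_add_one_ne_zero l
    have := one_sub_I_mul_ne_zero ξ
    refine (((hasDerivAt_cayley ξ).pow (l + 1)).div_const (2 * Complex.I * (l + 1))).congr_deriv ?_
    rw [Nat.add_sub_cancel, Nat.cast_add_one]
    field_simp
  have hlim := (tendsto_cayley_cocompact.pow (l + 1)).div_const (2 * Complex.I * (l + 1))
  rw [integral_of_hasDerivAt_of_tendsto hderiv (integrable_cayley_pow_div l)
    (hlim.mono_left atBot_le_cocompact) (hlim.mono_left atTop_le_cocompact), sub_self]

/-- For every `l ∈ ℕ`, the function `ξ ↦ (1/(1 − iξ)) · conj(φ_l(ξ))`,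
where `φ_l(ξ) = (1 − iξ)^l / (1 + iξ)^{l+1}`, is integrable on `ℝ` with integral `0`;
i.e. `1/(1 − iξ)` is orthogonal in `L²(ℝ)` to every `φ_l`. -/
theorem one_div_one_sub_I_orthogonal_phi :
    ∀ l : ℕ,
      Integrable (fun ξ : ℝ =>
        (1 / (1 - Complex.I * ξ)) *
          (starRingEnd ℂ) ((1 - Complex.I * ξ) ^ l / (1 + Complex.I * ξ) ^ (l + 1))) ∧
      ∫ ξ : ℝ,
          (1 / (1 - Complex.I * ξ)) *
            (starRingEnd ℂ) ((1 - Complex.I * ξ) ^ l / (1 + Complex.I * ξ) ^ (l + 1)) = 0 := by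
  intro l
  simp only [one_div_mul_conj_phi_eq]
  exact ⟨integrable_cayley_pow_div l, integral_cayley_pow_div l⟩
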